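/- Let n and k be integers with k ≥ 1 and 2k < n + 2, and let ω : ℝ → ℝ be smooth with compact support contained in (0,∞). Set C(k,n) = Γ(n/2+1−k)/(2^{2k−1}·(k−1)!·Γ(n/2+1)) and, for 0 < r ≤ s, φ_k(r,s) = C(k,n)·s^{2k−2−n}·∑_{j=0}^{k−1} (−1)^j·binom(k−1,j)·((n/2+1−k)_j/(n/2+1)_j)·(r/s)^{2j}, and δ_k(r,s) = r·s·φ_k(r,s). Define u : ℝ → ℝ by u(r) = ∫_0^r δ_k(s,r)·s^{n−1}·ω(s) ds + ∫_r^∞ δ_k(r,s)·s^{n−1}·ω(s) ds for r > 0 and u(r) = 0 for r ≤ 0. Define the operator L on functions f : ℝ → ℝ by (Lf)(r) = deriv(deriv f)(r) + ((n−1)/r)·deriv f(r) − ((n−1)/r²)·f(r). Then the k-fold iterate of the map f ↦ −Lf applied to u agrees with ω at every r > 0. -/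

import Mathlib

open MeasureTheory

/-- The rising factorial (Pochhammer symbol) `(x)_j = x(x+1)⋯(x+j-1)`. -/
noncomputable def risingFactorial (j : ℕ) (x : ℝ) : ℝ := (ascPochhammer ℝ j).eval x

/-- The constant `C(k,n) = Γ(n/2+1-k)/(2^{2k-1} (k-1)! Γ(n/2+1))`. -/
noncomputable def Ckn (k n : ℕ) : ℝ :=
  Real.Gamma ((n : ℝ) / 2 + 1 - k)
    / (2 ^ (2 * k - 1) * (Nat.factorial (k - 1) : ℝ) * Real.Gamma ((n : ℝ) / 2 + 1))

/-- The kernel factor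
`φ_k(r,s) = C(k,n) s^{2k-2-n} ∑_{j=0}^{k-1} (-1)^j binom(k-1,j) ((n/2+1-k)_j/(n/2+1)_j) (r/s)^{2j}`. -/
noncomputable def phiK (k n : ℕ) (r s : ℝ) : ℝ :=
  Ckn k n * s ^ (2 * (k : ℤ) - 2 - (n : ℤ))
    * ∑ j ∈ Finset.range k,
        (-1 : ℝ) ^ j * (Nat.choose (k - 1) j : ℝ)
          * (risingFactorial j ((n : ℝ) / 2 + 1 - k) / risingFactorial j ((n : ℝ) / 2 + 1))
          * (r / s) ^ (2 * j)

/-- The Green-function kernel `δ_k(r,s) = r s φ_k(r,s)`. -/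
noncomputable def deltaK (k n : ℕ) (r s : ℝ) : ℝ := r * s * phiK k n r s

/-- The radial vector Laplacian acting on the radial component:
`(L f)(r) = f''(r) + ((n-1)/r) f'(r) - ((n-1)/r²) f(r)`. -/
noncomputable def radialLap (n : ℕ) (f : ℝ → ℝ) : ℝ → ℝ :=
  fun r => deriv (deriv f) r + (((n : ℝ) - 1) / r) * deriv f r
    - (((n : ℝ) - 1) / r ^ 2) * f r

/-- The coefficient of `r ^ (2 j + 1) s ^ (2 m + 1 - n - 2 j)` in `deltaK (m + 1) n r s`. -/
noncomputable def greenCoeff (m n j : ℕ) : ℝ :=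
  Ckn (m + 1) n * ((-1 : ℝ) ^ j * (Nat.choose m j : ℝ)
    * (risingFactorial j ((n : ℝ) / 2 - m) / risingFactorial j ((n : ℝ) / 2 + 1)))

lemma risingFactorial_zero (x : ℝ) : risingFactorial 0 x = 1 := by
  simp [risingFactorial]

lemma risingFactorial_succ_right (j : ℕ) (x : ℝ) :
    risingFactorial (j + 1) x = risingFactorial j x * (x + j) := by
  simp [risingFactorial, ascPochhammer_succ_eval]

lemma risingFactorial_succ_left (j : ℕ) (x : ℝ) :
    risingFactorial (j + 1) x = x * risingFactorial j (x + 1) := by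
  simp [risingFactorial, ascPochhammer_succ_left, Polynomial.eval_comp]

lemma risingFactorial_pos (j : ℕ) {x : ℝ} (hx : 0 < x) : 0 < risingFactorial j x :=
  ascPochhammer_pos j x hx

lemma Ckn_succ (m n : ℕ) (h : 2 * (m + 2) < n + 2) :
    Ckn (m + 1) n = 4 * (m + 1) * ((n : ℝ) / 2 - (m + 1)) * Ckn (m + 2) n := by
  have hb : (0 : ℝ) < (n : ℝ) / 2 - (m + 1) := by
    have : (2 * (m + 2) : ℝ) < n + 2 := by exact_mod_cast h
    linarith
  have hG := Real.Gamma_add_one hb.ne'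
  have hx : 0 < Real.Gamma ((n : ℝ) / 2 + 1) := Real.Gamma_pos_of_pos (by positivity)
  have hf : ((m + 1).factorial : ℝ) = (m + 1) * (m.factorial : ℝ) := by
    rw [Nat.factorial_succ]; push_cast; ring
  have hf0 : (m.factorial : ℝ) ≠ 0 := by exact_mod_cast m.factorial_ne_zero
  have e1 : (n : ℝ) / 2 + 1 - ((m + 1 : ℕ) : ℝ) = (n : ℝ) / 2 - (m + 1) + 1 := by
    push_cast; ring
  have e2 : (n : ℝ) / 2 + 1 - ((m + 2 : ℕ) : ℝ) = (n : ℝ) / 2 - (m + 1) := by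
    push_cast; ring
  have e3 : 2 * (m + 1) - 1 = 2 * m + 1 := by omega
  have e4 : 2 * (m + 2) - 1 = 2 * m + 3 := by omega
  have e5 : m + 1 - 1 = m := by omega
  have e6 : m + 2 - 1 = m + 1 := by omega
  have hm : (m : ℝ) + 1 ≠ 0 := by positivity
  unfold Ckn
  rw [e1, e2, e3, e4, e5, e6, hG, hf]
  field_simp
  ring

lemma greenCoeff_outer (m n j : ℕ) (h : 2 * (m + 2) < n + 2) (hj : j ≤ m + 1) :
    4 * ((n : ℝ) / 2 - (m + 1) + j) * (m + 1 - j) * greenCoeff (m + 1) n j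
      = greenCoeff m n j := by
  have hr : risingFactorial j ((n : ℝ) / 2 - (m + 1)) * ((n : ℝ) / 2 - (m + 1) + j)
      = ((n : ℝ) / 2 - (m + 1)) * risingFactorial j ((n : ℝ) / 2 - m) := by
    rw [← risingFactorial_succ_right, risingFactorial_succ_left]
    congr 2; ring
  have hc : (m.choose j : ℝ) * (m + 1) = ((m + 1).choose j : ℝ) * (m + 1 - j) := by
    have := Nat.choose_mul_succ_eq m j
    rw [← @Nat.cast_inj ℝ] at this
    rw [Nat.cast_mul, Nat.cast_mul, Nat.cast_sub hj] at this
    exact_mod_cast this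
  unfold greenCoeff
  rw [Ckn_succ m n h]
  push_cast
  calc _ = 4 * Ckn (m + 2) n * (-1) ^ j * (((m + 1).choose j : ℝ) * (m + 1 - j)) *
        (risingFactorial j ((n : ℝ) / 2 - (m + 1)) * ((n : ℝ) / 2 - (m + 1) + j))
          / risingFactorial j ((n : ℝ) / 2 + 1) := by ring
    _ = _ := by rw [hr, ← hc]; ring

lemma greenCoeff_inner (m n j : ℕ) (h : 2 * (m + 2) < n + 2) :
    -(4 * (j + 1) * ((n : ℝ) / 2 + 1 + j) * greenCoeff (m + 1) n (j + 1))
      = greenCoeff m n j := by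
  have hx : (0 : ℝ) < (n : ℝ) / 2 + 1 + j := by positivity
  have hp := risingFactorial_pos j (show (0 : ℝ) < (n : ℝ) / 2 + 1 by positivity)
  have hc : ((m : ℝ) + 1) * (m.choose j : ℝ) = ((m + 1).choose (j + 1) : ℝ) * (j + 1) := by
    exact_mod_cast Nat.add_one_mul_choose_eq m j
  have e : (n : ℝ) / 2 - ((m + 1 : ℕ) : ℝ) + 1 = (n : ℝ) / 2 - m := by push_cast; ring
  unfold greenCoeff
  rw [Ckn_succ m n h, risingFactorial_succ_left j ((n : ℝ) / 2 - ((m + 1 : ℕ) : ℝ)), e,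
    risingFactorial_succ_right]
  push_cast
  calc _ = 4 * Ckn (m + 2) n * (-1) ^ j * (((m + 1).choose (j + 1) : ℝ) * (j + 1)) *
        ((n : ℝ) / 2 - (m + 1)) * risingFactorial j ((n : ℝ) / 2 - m)
          / risingFactorial j ((n : ℝ) / 2 + 1) := by field_simp; ring
    _ = _ := by rw [← hc]; ring

/-- Telescoped partial sums of the jump of the first derivative across the diagonal. -/
lemma sum_greenCoeff_jump_partial (m n J : ℕ) :
    (m + 1) * ∑ j ∈ Finset.range J, greenCoeff (m + 1) n j * ((n : ℝ) / 2 - (m + 1) + 2 * j)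
      = -(J * ((n : ℝ) / 2 + J) * greenCoeff (m + 1) n J) := by
  induction J with
  | zero => simp
  | succ J ih =>
    rw [Finset.sum_range_succ, mul_add, ih]
    have hx : (0 : ℝ) < (n : ℝ) / 2 + 1 + J := by positivity
    have hp := risingFactorial_pos J (show (0 : ℝ) < (n : ℝ) / 2 + 1 by positivity)
    have hc : ((m + 1).choose (J + 1) : ℝ) * (J + 1) = ((m + 1).choose J : ℝ) * (m + 1 - J) := by
      rcases le_or_gt J (m + 1) with hJ | hJ
      · have := Nat.choose_succ_right_eq (m + 1) J
        rw [← @Nat.cast_inj ℝ, Nat.cast_mul, Nat.cast_mul, Nat.cast_sub hJ] at this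
        exact_mod_cast this
      · rw [Nat.choose_eq_zero_of_lt hJ, Nat.choose_eq_zero_of_lt (hJ.trans (Nat.lt_succ_self J))]
        simp
    have key : -((J + 1) * ((n : ℝ) / 2 + 1 + J) * greenCoeff (m + 1) n (J + 1))
        = ((m : ℝ) + 1 - J) * ((n : ℝ) / 2 - (m + 1) + J) * greenCoeff (m + 1) n J := by
      unfold greenCoeff
      rw [risingFactorial_succ_right, risingFactorial_succ_right]
      push_cast
      calc _ = Ckn (m + 1 + 1) n * (-1) ^ J * (((m + 1).choose (J + 1) : ℝ) * (J + 1)) *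
            (risingFactorial J ((n : ℝ) / 2 - (m + 1)) * ((n : ℝ) / 2 - (m + 1) + J))
              / risingFactorial J ((n : ℝ) / 2 + 1) := by field_simp; ring
        _ = _ := by rw [hc]; ring
    push_cast
    rw [show (n : ℝ) / 2 + (J + 1) = (n : ℝ) / 2 + 1 + J by ring, key]
    ring

lemma sum_greenCoeff_jump (m n : ℕ) :
    ∑ j ∈ Finset.range (m + 2), greenCoeff (m + 1) n j * ((n : ℝ) / 2 - (m + 1) + 2 * j) = 0 := by
  have h := sum_greenCoeff_jump_partial m n (m + 2)
  have h0 : greenCoeff (m + 1) n (m + 2) = 0 := by simp [greenCoeff]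
  rw [h0, mul_zero, neg_zero] at h
  exact (mul_eq_zero.1 h).resolve_left (by positivity)

lemma deltaK_eq_sum (m n : ℕ) (r : ℝ) {s : ℝ} (hs : s ≠ 0) :
    deltaK (m + 1) n r s = ∑ j ∈ Finset.range (m + 1),
      greenCoeff m n j * (r ^ (2 * (j : ℤ) + 1) * s ^ (2 * (m : ℤ) + 1 - n - 2 * j)) := by
  unfold deltaK phiK
  rw [Finset.mul_sum, Finset.mul_sum]
  refine Finset.sum_congr rfl fun j _ => ?_
  have e1 : (n : ℝ) / 2 + 1 - ((m + 1 : ℕ) : ℝ) = (n : ℝ) / 2 - m := by push_cast; ring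
  have e2 : r ^ (2 * (j : ℤ) + 1) = r * r ^ (2 * j) := by
    rw [← pow_succ', ← zpow_natCast]; push_cast; rfl
  have e3 : s ^ (2 * (m : ℤ) + 1 - n - 2 * j)
      = s * s ^ (2 * ((m + 1 : ℕ) : ℤ) - 2 - (n : ℤ)) * (s ^ (2 * j))⁻¹ := by
    rw [← zpow_natCast s (2 * j), ← zpow_neg, ← zpow_one_add₀ hs, ← zpow_add₀ hs]
    congr 1; push_cast; ring
  rw [e1, e2, e3, Nat.add_sub_cancel, div_pow]
  unfold greenCoeff
  ring

lemma continuous_zpow_mul_of_tsupport_subset {g : ℝ → ℝ} (hg : Continuous g)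
    (hpos : tsupport g ⊆ Set.Ioi 0) (q : ℤ) (N : ℕ) :
    Continuous fun s : ℝ => s ^ q * s ^ N * g s := by
  rw [continuous_iff_continuousAt]
  intro s
  rcases eq_or_ne s 0 with rfl | hs
  · have h0 : (0 : ℝ) ∉ tsupport g := fun h => (Set.mem_Ioi.1 (hpos h)).false
    have h1 := notMem_tsupport_iff_eventuallyEq.1 h0
    refine (continuousAt_const (y := (0 : ℝ))).congr ?_
    filter_upwards [h1] with x hx
    simp [hx]
  · exact ((continuousAt_zpow₀ s q (Or.inl hs)).mul (continuous_pow N).continuousAt).mul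
      hg.continuousAt

section Potential

variable (n : ℕ) (ω : ℝ → ℝ) (p q : ℤ)

/-- The moment of `ω` of order `p` over `(0, r)`, with respect to the radial measure. -/
noncomputable def innerMoment (r : ℝ) : ℝ := ∫ s in (0 : ℝ)..r, s ^ p * s ^ (n - 1) * ω s

/-- The moment of `ω` of order `q` over `(r, ∞)`, with respect to the radial measure. -/
noncomputable def outerMoment (r : ℝ) : ℝ := ∫ s in Set.Ioi r, s ^ q * s ^ (n - 1) * ω s

variable {n ω}

lemma integrable_moment (hω : Continuous ω) (hsupp : HasCompactSupport ω)
    (hpos : tsupport ω ⊆ Set.Ioi 0) : Integrable fun s : ℝ => s ^ p * s ^ (n - 1) * ω s :=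
  (continuous_zpow_mul_of_tsupport_subset hω hpos p (n - 1)).integrable_of_hasCompactSupport
    (hsupp.mul_left)

lemma hasDerivAt_innerMoment (hω : Continuous ω) (hpos : tsupport ω ⊆ Set.Ioi 0) (r : ℝ) :
    HasDerivAt (innerMoment n ω p) (r ^ p * r ^ (n - 1) * ω r) r :=
  (continuous_zpow_mul_of_tsupport_subset hω hpos p (n - 1)).integral_hasStrictDerivAt 0 r
    |>.hasDerivAt

lemma hasDerivAt_outerMoment (hω : Continuous ω) (hsupp : HasCompactSupport ω)
    (hpos : tsupport ω ⊆ Set.Ioi 0) (r : ℝ) :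
    HasDerivAt (outerMoment n ω q) (-(r ^ q * r ^ (n - 1) * ω r)) r := by
  have hi := integrable_moment (n := n) q hω hsupp hpos
  have h : outerMoment n ω q = fun x => outerMoment n ω q 0 - innerMoment n ω q x := by
    funext x
    rw [eq_sub_iff_add_eq']
    exact intervalIntegral.integral_interval_add_Ioi hi.integrableOn hi.integrableOn
  rw [h]
  exact (hasDerivAt_innerMoment q hω hpos r).const_sub _

lemma hasDerivAt_potential (hω : Continuous ω) (hsupp : HasCompactSupport ω)
    (hpos : tsupport ω ⊆ Set.Ioi 0) {r : ℝ} (hr : r ≠ 0) :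
    HasDerivAt (fun x => x ^ q * innerMoment n ω p x + x ^ p * outerMoment n ω q x)
      (q * r ^ (q - 1) * innerMoment n ω p r + p * r ^ (p - 1) * outerMoment n ω q r) r := by
  refine (((hasDerivAt_zpow q r (Or.inl hr)).mul (hasDerivAt_innerMoment p hω hpos r)).add
    ((hasDerivAt_zpow p r (Or.inl hr)).mul
      (hasDerivAt_outerMoment q hω hsupp hpos r))).congr_deriv ?_
  ring

lemma hasDerivAt_deriv_potential (hω : Continuous ω) (hsupp : HasCompactSupport ω)
    (hpos : tsupport ω ⊆ Set.Ioi 0) {r : ℝ} (hr : r ≠ 0) :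
    HasDerivAt (fun x => q * x ^ (q - 1) * innerMoment n ω p x
        + p * x ^ (p - 1) * outerMoment n ω q x)
      (q * (q - 1) * r ^ (q - 2) * innerMoment n ω p r
        + p * (p - 1) * r ^ (p - 2) * outerMoment n ω q r
        + (q - p) * (r ^ (p + q - 1) * r ^ (n - 1) * ω r)) r := by
  refine ((((hasDerivAt_zpow (q - 1) r (Or.inl hr)).const_mul (q : ℝ)).mul
      (hasDerivAt_innerMoment p hω hpos r)).add
    (((hasDerivAt_zpow (p - 1) r (Or.inl hr)).const_mul (p : ℝ)).mul
      (hasDerivAt_outerMoment q hω hsupp hpos r))).congr_deriv ?_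
  have e1 : r ^ (p + q - 1) = r ^ (q - 1) * r ^ p := by
    rw [← zpow_add₀ hr]; congr 1; ring
  have e2 : r ^ (p - 1) * r ^ q = r ^ (q - 1) * r ^ p := by
    rw [← zpow_add₀ hr, ← zpow_add₀ hr]; congr 1; ring
  rw [show q - 1 - 1 = q - 2 by ring, show p - 1 - 1 = p - 2 by ring, e1]
  push_cast
  linear_combination (-(p : ℝ) * r ^ (n - 1) * ω r) * e2

end Potential

lemma neg_radialLap_sum_potential {n : ℕ} {ω : ℝ → ℝ} (hω : Continuous ω)
    (hsupp : HasCompactSupport ω) (hpos : tsupport ω ⊆ Set.Ioi 0) (S : Finset ℕ) (c : ℕ → ℝ)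
    (p q : ℕ → ℤ) {u : ℝ → ℝ}
    (hu : ∀ r : ℝ, 0 < r → u r = ∑ j ∈ S, c j *
      (r ^ q j * innerMoment n ω (p j) r + r ^ p j * outerMoment n ω (q j) r))
    {r : ℝ} (hr : 0 < r) :
    -(radialLap n u r) =
      ∑ j ∈ S, -(((q j : ℝ) - 1) * (q j + n - 1) * c j) * (r ^ (q j - 2) * innerMoment n ω (p j) r)
      + ∑ j ∈ S, -(((p j : ℝ) - 1) * (p j + n - 1) * c j) *
          (r ^ (p j - 2) * outerMoment n ω (q j) r)
      + ∑ j ∈ S, c j * ((p j : ℝ) - q j) * (r ^ (p j + q j - 1) * r ^ (n - 1) * ω r) := by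
  have hnear : ∀ x : ℝ, 0 < x → ∀ᶠ y in nhds x, 0 < y := fun x hx => lt_mem_nhds hx
  have h1 : ∀ x : ℝ, 0 < x → deriv u x = ∑ j ∈ S, c j *
      (q j * x ^ (q j - 1) * innerMoment n ω (p j) x
        + p j * x ^ (p j - 1) * outerMoment n ω (q j) x) := by
    intro x hx
    have hd := HasDerivAt.fun_sum (u := S) fun j _ =>
      (hasDerivAt_potential (n := n) (p j) (q j) hω hsupp hpos hx.ne').const_mul (c j)
    exact (hd.congr_of_eventuallyEq ((hnear x hx).mono hu)).deriv
  have hd2 := HasDerivAt.fun_sum (u := S) fun j _ =>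
      (hasDerivAt_deriv_potential (n := n) (p j) (q j) hω hsupp hpos hr.ne').const_mul (c j)
  have h2 := (hd2.congr_of_eventuallyEq ((hnear r hr).mono h1)).deriv
  unfold radialLap
  rw [h2, h1 r hr, hu r hr, Finset.mul_sum, Finset.mul_sum, ← Finset.sum_add_distrib,
    ← Finset.sum_sub_distrib, ← Finset.sum_neg_distrib, ← Finset.sum_add_distrib,
    ← Finset.sum_add_distrib]
  refine Finset.sum_congr rfl fun j _ => ?_
  have e1 : ∀ a : ℤ, r ^ (a - 1) = r ^ (a - 2) * r := fun a => by
    rw [← zpow_add_one₀ hr.ne']; congr 1; ring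
  have e2 : ∀ a : ℤ, r ^ a = r ^ (a - 2) * r ^ 2 := fun a => by
    rw [← zpow_natCast r 2, ← zpow_add₀ hr.ne']; congr 1; push_cast; ring
  rw [e1 (q j), e1 (p j), e2 (q j), e2 (p j)]
  field_simp
  ring

lemma greenPotential_eq_sum {n : ℕ} {ω : ℝ → ℝ} (m : ℕ) (hω : Continuous ω)
    (hsupp : HasCompactSupport ω) (hpos : tsupport ω ⊆ Set.Ioi 0) {r : ℝ} (hr : 0 < r) :
    (∫ s in (0:ℝ)..r, deltaK (m + 1) n s r * s ^ (n - 1) * ω s)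
        + ∫ s in Set.Ioi r, deltaK (m + 1) n r s * s ^ (n - 1) * ω s
      = ∑ j ∈ Finset.range (m + 1), greenCoeff m n j *
        (r ^ (2 * (m : ℤ) + 1 - n - 2 * j) * innerMoment n ω (2 * (j : ℤ) + 1) r
          + r ^ (2 * (j : ℤ) + 1) * outerMoment n ω (2 * (m : ℤ) + 1 - n - 2 * j) r) := by
  have hi := fun p => integrable_moment (n := n) p hω hsupp hpos
  have h1 : (∫ s in (0:ℝ)..r, deltaK (m + 1) n s r * s ^ (n - 1) * ω s)
      = ∑ j ∈ Finset.range (m + 1), greenCoeff m n j *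
        (r ^ (2 * (m : ℤ) + 1 - n - 2 * j) * innerMoment n ω (2 * (j : ℤ) + 1) r) := by
    unfold innerMoment
    simp_rw [← intervalIntegral.integral_const_mul]
    rw [← intervalIntegral.integral_finsetSum fun j _ =>
      (((hi _).const_mul _).const_mul _).intervalIntegrable]
    refine intervalIntegral.integral_congr fun s _ => ?_
    simp only [deltaK_eq_sum m n s hr.ne', Finset.sum_mul]
    exact Finset.sum_congr rfl fun j _ => by ring
  have h2 : (∫ s in Set.Ioi r, deltaK (m + 1) n r s * s ^ (n - 1) * ω s)
      = ∑ j ∈ Finset.range (m + 1), greenCoeff m n j *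
        (r ^ (2 * (j : ℤ) + 1) * outerMoment n ω (2 * (m : ℤ) + 1 - n - 2 * j) r) := by
    unfold outerMoment
    simp_rw [← integral_const_mul]
    rw [← integral_finsetSum _ fun j _ => (((hi _).const_mul _).const_mul _).integrableOn]
    refine setIntegral_congr_fun measurableSet_Ioi fun s hs => ?_
    simp only [deltaK_eq_sum m n r (hr.trans hs).ne', Finset.sum_mul]
    exact Finset.sum_congr rfl fun j _ => by ring
  rw [h1, h2, ← Finset.sum_add_distrib]
  exact Finset.sum_congr rfl fun j _ => by ring

lemma greenCoeff_zero_zero {n : ℕ} (hn : 0 < n) : greenCoeff 0 n 0 * n = 1 := by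
  have hn' : (0 : ℝ) < (n : ℝ) / 2 := by positivity
  have hG := Real.Gamma_pos_of_pos hn'
  have hn0 : (n : ℝ) ≠ 0 := by positivity
  simp only [greenCoeff, Ckn, risingFactorial_zero]
  rw [Real.Gamma_add_one hn'.ne']
  simp
  field_simp

/-- The negative radial Laplacian inverts the lowest-order Green potential. -/
lemma neg_radialLap_greenPotential_zero {n : ℕ} {ω : ℝ → ℝ} (hn : 0 < n) (hω : Continuous ω)
    (hsupp : HasCompactSupport ω) (hpos : tsupport ω ⊆ Set.Ioi 0) {u : ℝ → ℝ}
    (hu : ∀ r : ℝ, 0 < r → u r = ∑ j ∈ Finset.range (0 + 1), greenCoeff 0 n j *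
        (r ^ (2 * ((0 : ℕ) : ℤ) + 1 - n - 2 * j) * innerMoment n ω (2 * (j : ℤ) + 1) r
          + r ^ (2 * (j : ℤ) + 1) * outerMoment n ω (2 * ((0 : ℕ) : ℤ) + 1 - n - 2 * j) r))
    {r : ℝ} (hr : 0 < r) : -(radialLap n u r) = ω r := by
  rw [neg_radialLap_sum_potential hω hsupp hpos _ _ (fun j => 2 * (j : ℤ) + 1)
    (fun j => 2 * ((0 : ℕ) : ℤ) + 1 - n - 2 * j) hu hr]
  have e : r ^ (1 + (1 - (n : ℤ)) - 1) * r ^ (n - 1) = 1 := by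
    rw [← zpow_natCast, ← zpow_add₀ hr.ne', Nat.cast_sub hn]
    simp
  have hc := greenCoeff_zero_zero hn
  simp only [zero_add, Finset.sum_range_one]
  push_cast
  simp only [sub_zero, e]
  linear_combination ω r * hc

/-- The negative radial Laplacian lowers the order of a Green potential by one. -/
lemma neg_radialLap_greenPotential_succ {n m : ℕ} {ω : ℝ → ℝ} (h : 2 * (m + 2) < n + 2)
    (hω : Continuous ω) (hsupp : HasCompactSupport ω) (hpos : tsupport ω ⊆ Set.Ioi 0)
    {u : ℝ → ℝ}
    (hu : ∀ r : ℝ, 0 < r → u r = ∑ j ∈ Finset.range (m + 1 + 1), greenCoeff (m + 1) n j *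
        (r ^ (2 * ((m + 1 : ℕ) : ℤ) + 1 - n - 2 * j) * innerMoment n ω (2 * (j : ℤ) + 1) r
          + r ^ (2 * (j : ℤ) + 1) * outerMoment n ω (2 * ((m + 1 : ℕ) : ℤ) + 1 - n - 2 * j) r))
    {r : ℝ} (hr : 0 < r) :
    -(radialLap n u r) = ∑ j ∈ Finset.range (m + 1), greenCoeff m n j *
        (r ^ (2 * (m : ℤ) + 1 - n - 2 * j) * innerMoment n ω (2 * (j : ℤ) + 1) r
          + r ^ (2 * (j : ℤ) + 1) * outerMoment n ω (2 * (m : ℤ) + 1 - n - 2 * j) r) := by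
  rw [neg_radialLap_sum_potential hω hsupp hpos _ _ (fun j => 2 * (j : ℤ) + 1)
    (fun j => 2 * ((m + 1 : ℕ) : ℤ) + 1 - n - 2 * j) hu hr]
  have hjump : ∑ j ∈ Finset.range (m + 1 + 1), greenCoeff (m + 1) n j *
      (((2 * (j : ℤ) + 1 : ℤ) : ℝ) - ((2 * ((m + 1 : ℕ) : ℤ) + 1 - n - 2 * j : ℤ) : ℝ)) *
      (r ^ (2 * (j : ℤ) + 1 + (2 * ((m + 1 : ℕ) : ℤ) + 1 - n - 2 * j) - 1) * r ^ (n - 1) * ω r)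
      = 0 := by
    have hs := sum_greenCoeff_jump m n
    rw [← mul_zero (2 * (r ^ (2 * (m : ℤ) + 3 - n) * r ^ (n - 1) * ω r)), ← hs, Finset.mul_sum]
    refine Finset.sum_congr rfl fun j _ => ?_
    rw [show 2 * (j : ℤ) + 1 + (2 * ((m + 1 : ℕ) : ℤ) + 1 - n - 2 * j) - 1
      = 2 * (m : ℤ) + 3 - n by push_cast; ring]
    push_cast
    ring
  have hF : ∑ j ∈ Finset.range (m + 1 + 1),
      -((((2 * ((m + 1 : ℕ) : ℤ) + 1 - n - 2 * j : ℤ) : ℝ) - 1) *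
        (((2 * ((m + 1 : ℕ) : ℤ) + 1 - n - 2 * j : ℤ) : ℝ) + n - 1) * greenCoeff (m + 1) n j) *
        (r ^ (2 * ((m + 1 : ℕ) : ℤ) + 1 - n - 2 * j - 2) * innerMoment n ω (2 * (j : ℤ) + 1) r)
      = ∑ j ∈ Finset.range (m + 1), greenCoeff m n j *
        (r ^ (2 * (m : ℤ) + 1 - n - 2 * j) * innerMoment n ω (2 * (j : ℤ) + 1) r) := by
    rw [Finset.sum_range_succ]
    conv_rhs => rw [← add_zero (Finset.sum _ _)]
    congr 1
    · refine Finset.sum_congr rfl fun j hj => ?_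
      rw [← greenCoeff_outer m n j h (Finset.mem_range.1 hj).le,
        show 2 * ((m + 1 : ℕ) : ℤ) + 1 - n - 2 * j - 2 = 2 * (m : ℤ) + 1 - n - 2 * j by
          push_cast; ring]
      push_cast
      ring
    · push_cast
      ring
  have hG : ∑ j ∈ Finset.range (m + 1 + 1),
      -((((2 * (j : ℤ) + 1 : ℤ) : ℝ) - 1) *
        (((2 * (j : ℤ) + 1 : ℤ) : ℝ) + n - 1) * greenCoeff (m + 1) n j) *
        (r ^ (2 * (j : ℤ) + 1 - 2) * outerMoment n ω (2 * ((m + 1 : ℕ) : ℤ) + 1 - n - 2 * j) r)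
      = ∑ j ∈ Finset.range (m + 1), greenCoeff m n j *
        (r ^ (2 * (j : ℤ) + 1) * outerMoment n ω (2 * (m : ℤ) + 1 - n - 2 * j) r) := by
    rw [Finset.sum_range_succ']
    conv_rhs => rw [← add_zero (Finset.sum _ _)]
    congr 1
    · refine Finset.sum_congr rfl fun j _ => ?_
      rw [← greenCoeff_inner m n j h,
        show 2 * ((m + 1 : ℕ) : ℤ) + 1 - n - 2 * ((j + 1 : ℕ) : ℤ)
          = 2 * (m : ℤ) + 1 - n - 2 * j by push_cast; ring,
        show 2 * ((j + 1 : ℕ) : ℤ) + 1 - 2 = 2 * (j : ℤ) + 1 by push_cast; ring]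
      push_cast
      ring
    · simp
  rw [hjump, hF, hG, add_zero, ← Finset.sum_add_distrib]
  exact Finset.sum_congr rfl fun j _ => by ring

lemma iterate_neg_radialLap_greenPotential {n : ℕ} {ω : ℝ → ℝ} (hω : Continuous ω)
    (hsupp : HasCompactSupport ω) (hpos : tsupport ω ⊆ Set.Ioi 0) (m : ℕ)
    (h : 2 * (m + 1) < n + 2) (u : ℝ → ℝ)
    (hu : ∀ r : ℝ, 0 < r → u r = ∑ j ∈ Finset.range (m + 1), greenCoeff m n j *
        (r ^ (2 * (m : ℤ) + 1 - n - 2 * j) * innerMoment n ω (2 * (j : ℤ) + 1) r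
          + r ^ (2 * (j : ℤ) + 1) * outerMoment n ω (2 * (m : ℤ) + 1 - n - 2 * j) r))
    {r : ℝ} (hr : 0 < r) :
    ((fun f : ℝ → ℝ => fun x => -(radialLap n f x))^[m + 1] u) r = ω r := by
  induction m generalizing u with
  | zero => exact neg_radialLap_greenPotential_zero (by omega) hω hsupp hpos hu hr
  | succ m ih =>
    rw [Function.iterate_succ_apply]
    exact ih (by omega) _ fun x hx =>
      neg_radialLap_greenPotential_succ (by omega) hω hsupp hpos hu hx

/-- The kernel `δ_k` is the Green function of `(-Δ)^k` on radial vector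
fields: for smooth `ω` with compact support in `(0,∞)`, the function
`u(r) = ∫_0^r δ_k(s,r) s^{n-1} ω(s) ds + ∫_r^∞ δ_k(r,s) s^{n-1} ω(s) ds` (and `u(r) = 0` for
`r ≤ 0`) satisfies `(-L)^k u = ω` on `(0,∞)`, where `L` is the radial vector Laplacian. -/
theorem green_function_higher_order
    (n k : ℕ) (hk : 1 ≤ k) (hkn : 2 * k < n + 2)
    (ω : ℝ → ℝ) (hω : ContDiff ℝ (⊤ : ℕ∞) ω) (hωsupp : HasCompactSupport ω)
    (hωpos : tsupport ω ⊆ Set.Ioi 0)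
    (u : ℝ → ℝ)
    (hu : ∀ r : ℝ, 0 < r →
      u r = (∫ s in (0:ℝ)..r, deltaK k n s r * s ^ (n - 1) * ω s)
            + ∫ s in Set.Ioi r, deltaK k n r s * s ^ (n - 1) * ω s)
    (hu0 : ∀ r : ℝ, r ≤ 0 → u r = 0) :
    ∀ r : ℝ, 0 < r →
      ((fun f : ℝ → ℝ => fun x => -(radialLap n f x))^[k] u) r = ω r := by
  obtain ⟨m, rfl⟩ : ∃ m, k = m + 1 := ⟨k - 1, by omega⟩
  exact fun r hr => iterate_neg_radialLap_greenPotential hω.continuous hωsupp hωpos m hkn u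
    (fun x hx => (hu x hx).trans
      (greenPotential_eq_sum m hω.continuous hωsupp hωpos hx)) hr
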